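/- Every possible joint outcome of the PR box witnesses a Hardy paradox: for all x y a b with PR x y a b > 0, there exist a₁ b₁ : Fin 2 such that PR x (1−y) a b₁ = 0, PR (1−x) y a₁ b = 0, and PR (1−x) (1−y) (1−a₁) (1−b₁) = 0 (here 1 − c denotes the other element of Fin 2). Consequently the PR box is strongly nonlocal: there is no pair of functions f g : Fin 2 → Fin 2 with PR x y (f x) (g y) > 0 for all x y; in particular, for each measurement context the total probability of obtaining an outcome that witnesses a Hardy paradox equals 1. -/

import Mathlib

/-- The Popescu-Rohrlich box: joint outcome `(a,b)` for measurements `(x,y)` has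
probability `1/2` if `a + b = x * y` in `ZMod 2`, and `0` otherwise. -/
noncomputable def PR (x y a b : Fin 2) : ℝ :=
  if ((a.val : ZMod 2) + (b.val : ZMod 2) = (x.val : ZMod 2) * (y.val : ZMod 2))
  then 1 / 2 else 0

/-- The outcome `(a,b)` of the measurement context `(x,y)` witnesses a Hardy paradox
in the PR box. -/
def PRWitnessesHardy (x y a b : Fin 2) : Prop :=
  ∃ a₁ b₁ : Fin 2, PR x (1 - y) a b₁ = 0 ∧ PR (1 - x) y a₁ b = 0 ∧
    PR (1 - x) (1 - y) (1 - a₁) (1 - b₁) = 0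

theorem PR_pos_iff (x y a b : Fin 2) : PR x y a b > 0 ↔
    ((a.val : ZMod 2) + (b.val : ZMod 2) = (x.val : ZMod 2) * (y.val : ZMod 2)) := by
  unfold PR
  split_ifs with h <;> simp [h]

theorem PR_zero_iff (x y a b : Fin 2) : PR x y a b = 0 ↔
    ¬ ((a.val : ZMod 2) + (b.val : ZMod 2) = (x.val : ZMod 2) * (y.val : ZMod 2)) := by
  unfold PR
  split_ifs with h <;> simp [h]

theorem PR_hardy (x y a b : Fin 2) (h : PR x y a b > 0) : PRWitnessesHardy x y a b := by
  unfold PRWitnessesHardy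
  simp only [PR_zero_iff]
  rw [PR_pos_iff] at h
  revert x y a b
  decide

theorem PR_indicator (x y a b : Fin 2) :
    Set.indicator {ab : Fin 2 × Fin 2 | PR x y ab.1 ab.2 > 0 ∧ PRWitnessesHardy x y ab.1 ab.2}
        (fun ab => PR x y ab.1 ab.2) (a, b) = PR x y a b := by
  by_cases h : PR x y a b > 0
  · rw [Set.indicator_of_mem]
    exact ⟨h, PR_hardy x y a b h⟩
  · rw [Set.indicator_of_notMem (by intro hm; exact h hm.1)]
    rw [PR_pos_iff] at h
    exact ((PR_zero_iff x y a b).2 h).symm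

theorem PR_sum (x y : Fin 2) : ∑ a : Fin 2, ∑ b : Fin 2, PR x y a b = 1 := by
  have h11 : (1 : ZMod 2) + 1 = 0 := by decide
  fin_cases x <;> fin_cases y <;> simp [Fin.sum_univ_two, PR, h11] <;> norm_num

/-- every possible joint outcome of the PR box witnesses a Hardy paradox;
consequently the PR box is strongly nonlocal, and for each measurement context the total
probability of obtaining an outcome that witnesses a Hardy paradox equals 1. -/
theorem stmt_5 :
    (∀ x y a b, PR x y a b > 0 → PRWitnessesHardy x y a b) ∧
    (¬ ∃ f g : Fin 2 → Fin 2, ∀ x y, PR x y (f x) (g y) > 0) ∧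
    (∀ x y, ∑ a : Fin 2, ∑ b : Fin 2,
      Set.indicator {ab : Fin 2 × Fin 2 | PR x y ab.1 ab.2 > 0 ∧ PRWitnessesHardy x y ab.1 ab.2}
        (fun ab => PR x y ab.1 ab.2) (a, b) = 1) := by
  refine ⟨PR_hardy, ?_, ?_⟩
  · rintro ⟨f, g, h⟩
    simp only [PR_pos_iff] at h
    have key : ∀ a c b d : Fin 2,
        ¬ (((a.val : ZMod 2) + b.val = 0) ∧ ((a.val : ZMod 2) + d.val = 0) ∧
          ((c.val : ZMod 2) + b.val = 0) ∧ ((c.val : ZMod 2) + d.val = 1)) := by decide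
    refine key (f 0) (f 1) (g 0) (g 1) ⟨?_, ?_, ?_, ?_⟩
    · simpa using h 0 0
    · simpa using h 0 1
    · simpa using h 1 0
    · simpa using h 1 1
  · intro x y
    simp only [PR_indicator]
    exact PR_sum x y
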